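/- Let S ⊆ Matrix ι ι ℂ be the block *-algebra ⊕_k (1_{d k} ⊗ M_{m k}(ℂ)) of the context. Then the private independence number of S equals max_k d k; that is: (i) there exists a private independent family for S of size max_k d k, and (ii) every private independent family for S has size at most max_k d k. (Part of the paper's Lemma computing the independence numbers of *-algebras: α_p(S) = max_k d_k.) -/

import Mathlib

open Matrix Kronecker ComplexOrder

noncomputable section

/-- The index type of the block decomposition `⊕ₖ (Fin (d k) × Fin (m k))`. -/
abbrev BlockIdx {K : ℕ} (d m : Fin K → ℕ) : Type :=
  (k : Fin K) × (Fin (d k) × Fin (m k))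

/-- The matrix supported on the diagonal block `k`, where it equals `1_{d k} ⊗ B`. -/
def blockMatrix {K : ℕ} (d m : Fin K → ℕ) (k : Fin K)
    (B : Matrix (Fin (m k)) (Fin (m k)) ℂ) :
    Matrix (BlockIdx d m) (BlockIdx d m) ℂ := fun p q =>
  if hp : p.1 = k then
    if hq : q.1 = k then
      if Fin.cast (congrArg d hp) p.2.1 = Fin.cast (congrArg d hq) q.2.1 then
        B (Fin.cast (congrArg m hp) p.2.2) (Fin.cast (congrArg m hq) q.2.2)
      else 0
    else 0
  else 0

/-- The block *-algebra `⊕ₖ (1_{d k} ⊗ M_{m k}(ℂ))`, as the span of the single-block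
matrices `blockMatrix d m k B`. -/
def blockAlgebra {K : ℕ} (d m : Fin K → ℕ) :
    Submodule ℂ (Matrix (BlockIdx d m) (BlockIdx d m) ℂ) :=
  Submodule.span ℂ
    {A | ∃ (k : Fin K) (B : Matrix (Fin (m k)) (Fin (m k)) ℂ), A = blockMatrix d m k B}

/-- A state: a positive semidefinite matrix of trace one. -/
def IsState {ι : Type*} [Fintype ι] (ρ : Matrix ι ι ℂ) : Prop :=
  ρ.PosSemidef ∧ ρ.trace = 1

/-- An independent family of states for a subspace `S` of matrices: the `|v⟩⟨w|` built from
vectors in the ranges of two distinct members are Hilbert–Schmidt orthogonal to `S`. -/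
def IsIndepFamily {ι : Type*} [Fintype ι] (S : Submodule ℂ (Matrix ι ι ℂ))
    {M : ℕ} (ρ : Fin M → Matrix ι ι ℂ) : Prop :=
  (∀ i, IsState (ρ i)) ∧
  ∀ i j : Fin M, i ≠ j →
    ∀ v ∈ Set.range (ρ i).mulVec, ∀ w ∈ Set.range (ρ j).mulVec,
      ∀ Y ∈ S, Matrix.trace (Yᴴ * Matrix.vecMulVec v (star w)) = 0

/-- A private independent family: an independent family whose state differences are also
orthogonal to `S`. -/
def IsPrivateIndepFamily {ι : Type*} [Fintype ι] (S : Submodule ℂ (Matrix ι ι ℂ))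
    {M : ℕ} (ρ : Fin M → Matrix ι ι ℂ) : Prop :=
  IsIndepFamily S ρ ∧
  ∀ i j : Fin M, i ≠ j → ∀ Y ∈ S, Matrix.trace (Yᴴ * (ρ i - ρ j)) = 0

/-- A Knill–Laflamme projection for `S`: an orthogonal projection `P` with `P S P ⊆ ℂ P`. -/
def IsKLProjection {ι : Type*} [Fintype ι] (S : Submodule ℂ (Matrix ι ι ℂ))
    (P : Matrix ι ι ℂ) : Prop :=
  Pᴴ = P ∧ P * P = P ∧ ∀ Y ∈ S, ∃ c : ℂ, P * Y * P = c • P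

/-- An entanglement-assisted independent family of size `M` for `S`. -/
def IsEAIndepFamily {ι : Type*} [Fintype ι] [DecidableEq ι]
    (S : Submodule ℂ (Matrix ι ι ℂ)) (M : ℕ) : Prop :=
  ∃ (n r : ℕ), 1 ≤ n ∧ 1 ≤ r ∧
    ∃ ρ : Matrix (Fin n) (Fin n) ℂ, IsState ρ ∧
      ∃ V : Fin M → Matrix (ι × Fin r) (Fin n) ℂ,
        (∀ i, (V i)ᴴ * V i = 1) ∧
        ∀ i i' : Fin M, i ≠ i' → ∀ Y ∈ S, ∀ W : Matrix (Fin r) (Fin r) ℂ,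
          Matrix.trace ((Y ⊗ₖ W)ᴴ * (V i * ρ * (V i')ᴴ)) = 0

end


lemma bm_diag {K : ℕ} (d m : Fin K → ℕ) (k : Fin K)
    (B : Matrix (Fin (m k)) (Fin (m k)) ℂ) (i j : Fin (d k)) (a b : Fin (m k)) :
    blockMatrix d m k B ⟨k, i, a⟩ ⟨k, j, b⟩ = if i = j then B a b else 0 := by
  simp [blockMatrix]

lemma bm_left {K : ℕ} (d m : Fin K → ℕ) (k : Fin K)
    (B : Matrix (Fin (m k)) (Fin (m k)) ℂ) (p q : BlockIdx d m) (h : p.1 ≠ k) :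
    blockMatrix d m k B p q = 0 := by
  simp [blockMatrix, h]

lemma bm_right {K : ℕ} (d m : Fin K → ℕ) (k : Fin K)
    (B : Matrix (Fin (m k)) (Fin (m k)) ℂ) (p q : BlockIdx d m) (h : q.1 ≠ k) :
    blockMatrix d m k B p q = 0 := by
  simp [blockMatrix, h]

lemma trace_formula {ι : Type*} [Fintype ι] (Y X : Matrix ι ι ℂ) :
    trace (Yᴴ * X) = ∑ p, ∑ q, star (Y p q) * X p q := by
  simp only [trace, diag_apply, mul_apply, conjTranspose_apply]
  exact Finset.sum_comm

lemma bm_trace {K : ℕ} (d m : Fin K → ℕ) (k : Fin K)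
    (B : Matrix (Fin (m k)) (Fin (m k)) ℂ) (X : Matrix (BlockIdx d m) (BlockIdx d m) ℂ) :
    trace ((blockMatrix d m k B)ᴴ * X) =
      ∑ i, ∑ a, ∑ b, star (B a b) * X ⟨k, i, a⟩ ⟨k, i, b⟩ := by
  rw [trace_formula, Fintype.sum_sigma, Finset.sum_eq_single k]
  · rw [Fintype.sum_prod_type]
    refine Finset.sum_congr rfl fun i _ => Finset.sum_congr rfl fun a _ => ?_
    rw [Fintype.sum_sigma, Finset.sum_eq_single k]
    · rw [Fintype.sum_prod_type, Finset.sum_eq_single i]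
      · simp [bm_diag]
      · intro j _ hj
        simp [bm_diag, hj.symm]
      · simp
    · intro l _ hl
      refine Finset.sum_eq_zero fun q _ => ?_
      rw [bm_right d m k B _ _ hl]; simp
    · simp
  · intro l _ hl
    refine Finset.sum_eq_zero fun q _ => Finset.sum_eq_zero fun q' _ => ?_
    rw [bm_left d m k B _ _ hl]; simp
  · simp

lemma mem_entries {K : ℕ} (d m : Fin K → ℕ) {Y : Matrix (BlockIdx d m) (BlockIdx d m) ℂ}
    (hY : Y ∈ blockAlgebra d m) (k : Fin K) (i j : Fin (d k)) (a : Fin (m k)) :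
    Y ⟨k, i, a⟩ ⟨k, i, a⟩ = Y ⟨k, j, a⟩ ⟨k, j, a⟩ ∧
      (i ≠ j → Y ⟨k, i, a⟩ ⟨k, j, a⟩ = 0) := by
  unfold blockAlgebra at hY
  induction hY using Submodule.span_induction with
  | mem x hx =>
    obtain ⟨l, B, rfl⟩ := hx
    by_cases h : k = l
    · subst h
      simp +contextual [bm_diag]
    · constructor
      · rw [bm_left d m l B _ _ h, bm_left d m l B _ _ h]
      · intro _
        rw [bm_left d m l B _ _ h]
  | zero => simp
  | add x y _ _ hx hy =>
    refine ⟨by simp [hx.1, hy.1], fun h => by simp [hx.2 h, hy.2 h]⟩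
  | smul c x _ hx =>
    refine ⟨by simp [hx.1], fun h => by simp [hx.2 h]⟩

lemma part_two {K : ℕ} (d m : Fin K → ℕ) (M : ℕ)
    (ρ : Fin M → Matrix (BlockIdx d m) (BlockIdx d m) ℂ)
    (h : IsPrivateIndepFamily (blockAlgebra d m) ρ) : M ≤ Finset.univ.sup d := by
  rcases Nat.eq_zero_or_pos M with rfl | hM
  · exact Nat.zero_le _
  obtain ⟨⟨hst, hind⟩, hpriv⟩ := h
  have hmem : ∀ k B, blockMatrix d m k B ∈ blockAlgebra d m := fun k B =>
    Submodule.subset_span ⟨k, B, rfl⟩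
  have htr : ∀ i, ∑ k, ∑ p : Fin (d k) × Fin (m k), ρ i ⟨k, p⟩ ⟨k, p⟩ = 1 := by
    intro i
    have := (hst i).2
    rw [trace, Fintype.sum_sigma] at this
    exact this
  have hT : ∀ k (X : Matrix (BlockIdx d m) (BlockIdx d m) ℂ),
      trace ((blockMatrix d m k 1)ᴴ * X) = ∑ p : Fin (d k) × Fin (m k), X ⟨k, p⟩ ⟨k, p⟩ := by
    intro k X
    rw [bm_trace, Fintype.sum_prod_type]
    refine Finset.sum_congr rfl fun i _ => Finset.sum_congr rfl fun a _ => ?_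
    rw [Finset.sum_eq_single a]
    · simp
    · intro b _ hb
      simp [Matrix.one_apply, hb.symm]
    · simp
  obtain ⟨k, -, hk⟩ : ∃ k ∈ Finset.univ,
      ∑ p : Fin (d k) × Fin (m k), ρ ⟨0, hM⟩ ⟨k, p⟩ ⟨k, p⟩ ≠ 0 := by
    apply Finset.exists_ne_zero_of_sum_ne_zero
    rw [htr]; exact one_ne_zero
  have hex : ∀ i, ∃ p : Fin (d k) × Fin (m k), ρ i ⟨k, p⟩ ⟨k, p⟩ ≠ 0 := by
    intro i
    have h1 : ∑ p : Fin (d k) × Fin (m k), ρ i ⟨k, p⟩ ⟨k, p⟩ ≠ 0 := by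
      by_cases hi : i = ⟨0, hM⟩
      · rw [hi]; exact hk
      · have := hpriv i _ hi _ (hmem k 1)
        rw [Matrix.mul_sub, trace_sub, hT, hT, sub_eq_zero] at this
        rw [this]; exact hk
    obtain ⟨p, -, hp⟩ := Finset.exists_ne_zero_of_sum_ne_zero h1
    exact ⟨p, hp⟩
  choose p hp using hex
  let u : Fin M → EuclideanSpace ℂ (Fin (d k)) := fun i =>
    WithLp.toLp 2 fun j => ρ i ⟨k, j, (p i).2⟩ ⟨k, p i⟩
  have hu0 : ∀ i, u i ≠ 0 := by
    intro i h0
    exact hp i (congrArg (fun x : EuclideanSpace ℂ (Fin (d k)) => x (p i).1) h0)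
  have hu : Pairwise fun i j => inner ℂ (u i) (u j) = 0 := by
    intro i j hij
    have hcol : ∀ i, (fun q => ρ i q ⟨k, p i⟩) ∈ Set.range (ρ i).mulVec := fun i =>
      ⟨Pi.single ⟨k, p i⟩ 1, by ext q; simp⟩
    have := hind j i hij.symm _ (hcol j) _ (hcol i) _
      (hmem k (Matrix.single (p j).2 (p i).2 1))
    rw [bm_trace] at this
    rw [PiLp.inner_apply, ← this]
    refine Finset.sum_congr rfl fun l _ => ?_
    rw [Finset.sum_eq_single (p j).2, Finset.sum_eq_single (p i).2]
    · simp [u, vecMulVec_apply]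
    · intro b _ hb
      simp [Matrix.single_apply, hb.symm]
    · simp
    · intro b _ hb
      simp [Matrix.single_apply, hb.symm]
    · simp
  have hli := linearIndependent_of_ne_zero_of_inner_eq_zero (𝕜 := ℂ) hu0 hu
  have := hli.fintype_card_le_finrank
  simp only [Fintype.card_fin, finrank_euclideanSpace] at this
  exact this.trans (Finset.le_sup (Finset.mem_univ k))

lemma part_one {K : ℕ} (d m : Fin K → ℕ) (k : Fin K) (hm : 1 ≤ m k) :
    ∃ ρ : Fin (d k) → Matrix (BlockIdx d m) (BlockIdx d m) ℂ,
      IsPrivateIndepFamily (blockAlgebra d m) ρ := by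
  let P : Fin (d k) → BlockIdx d m := fun i => ⟨k, i, ⟨0, hm⟩⟩
  have key : ∀ (Y : Matrix (BlockIdx d m) (BlockIdx d m) ℂ) (x y : BlockIdx d m) (c : ℂ),
      trace (Yᴴ * Matrix.single x y c) = star (Y x y) * c := by
    intro Y x y c
    rw [trace_formula, Finset.sum_eq_single x, Finset.sum_eq_single y]
    · simp
    · intro b _ hb
      simp [Matrix.single_apply, hb.symm]
    · simp
    · intro b _ hb
      simp [Matrix.single_apply, hb.symm]
    · simp
  refine ⟨fun i => Matrix.single (P i) (P i) 1, ⟨fun i => ⟨?_, ?_⟩, ?_⟩, ?_⟩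
  · beta_reduce
    rw [← Matrix.diagonal_single]
    refine Matrix.PosSemidef.diagonal ?_
    intro x
    by_cases hx : x = P i
    · subst hx; simp
    · simp [hx]
  · simp
  · rintro i j hij _ ⟨v, rfl⟩ _ ⟨w, rfl⟩ Y hY
    have : vecMulVec (Matrix.single (P i) (P i) (1 : ℂ) *ᵥ v)
        (star (Matrix.single (P j) (P j) (1 : ℂ) *ᵥ w)) =
        Matrix.single (P i) (P j) (v (P i) * star (w (P j))) := by
      ext x y
      by_cases hx : x = P i <;> by_cases hy : y = P j <;>
        simp [vecMulVec_apply, Matrix.single_mulVec, Matrix.single_apply, hx, hy, eq_comm]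
    rw [this, key, (mem_entries d m hY k i j ⟨0, hm⟩).2 hij]
    simp
  · intro i j hij Y hY
    rw [Matrix.mul_sub, trace_sub, key, key, (mem_entries d m hY k i j ⟨0, hm⟩).1, sub_self]

/-- The private independence number of the block *-algebra `⊕ₖ (1_{d k} ⊗ M_{m k}(ℂ))` is
`maxₖ d k`: there is a private independent family of that size, and no larger one. -/
theorem privateIndepNumber_blockAlgebra
    (K : ℕ) (hK : 1 ≤ K) (d m : Fin K → ℕ) (hd : ∀ k, 1 ≤ d k) (hm : ∀ k, 1 ≤ m k) :
    (∃ ρ : Fin (Finset.univ.sup d) → Matrix (BlockIdx d m) (BlockIdx d m) ℂ,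
      IsPrivateIndepFamily (blockAlgebra d m) ρ) ∧
    (∀ (M : ℕ) (ρ : Fin M → Matrix (BlockIdx d m) (BlockIdx d m) ℂ),
      IsPrivateIndepFamily (blockAlgebra d m) ρ → M ≤ Finset.univ.sup d) := by
  refine ⟨?_, fun M ρ h => part_two d m M ρ h⟩
  obtain ⟨k, -, hk⟩ := Finset.exists_mem_eq_sup Finset.univ ⟨⟨0, hK⟩, Finset.mem_univ _⟩ d
  rw [hk]
  exact part_one d m k (hm k)
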